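/- arXiv:1205.6690 — 5 statements merged into one kernel-verified Lean document; each statement's English description precedes it below -/
import Mathlib

section
/- Let Ψ be an expansion system, let m ≤ n, and suppose Ψ is proper w.r.t. y ∈ S_0 both at order n and at order m. Then Ψ is proper at order n and at order m w.r.t. y^{[n]} as well, and (y^{[n]})^{[m]} = y^{[m]}; in particular (y^{[n]})^{[n]} = y^{[n]}. -/
/-- An *expansion system* `Ψ`: element spaces `S i` with neutral elements `ν i`,
coefficient spaces `C i`, projections `P i : S i → C i` and expansions
`E i : S i → S (i+1)` such that `E i (ν i) = ν (i+1)` and each combined map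
`F i = (P i, E i) : S i → C i × S (i+1)` is injective. -/
structure ExpansionSystem where
  S : ℕ → Type*
  C : ℕ → Type*
  ν : ∀ i, S i
  P : ∀ i, S i → C i
  E : ∀ i, S i → S (i + 1)
  E_ν : ∀ i, E i (ν i) = ν (i + 1)
  F_inj : ∀ i, Function.Injective (fun y : S i => (P i y, E i y))

namespace ExpansionSystem

variable (Ψ : ExpansionSystem)

/-- `iter Ψ i y` is the element `y_i`: `y_0 = y`, `y_{i+1} = E i y_i`. -/
def iter : ∀ i : ℕ, Ψ.S 0 → Ψ.S i
  | 0, y => y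
  | (i + 1), y => Ψ.E i (iter i y)

/-- The `i`-th coefficient `P̂_i y = P i (y_i)`. -/
def coeff (i : ℕ) (y : Ψ.S 0) : Ψ.C i := Ψ.P i (Ψ.iter i y)

/-- The coefficient map `P̂ : S 0 → ∏ i, C i`. -/
def coeffMap (y : Ψ.S 0) : ∀ i, Ψ.C i := fun i => Ψ.coeff i y

/-- `a` records the backward recursion defining the `n`-th convergent of `y`:
`a n = ν n` and, for `i < n`, `F i (a i) = (P̂_i y, a (i+1))`, i.e.
`a i = F i ⁻¹ (P̂_i y, a (i+1))`; in particular at each step the pair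
`(P̂_i y, a (i+1))` lies in the image of `F i`. -/
def IsChain (n : ℕ) (y : Ψ.S 0) (a : ∀ i, Ψ.S i) : Prop :=
  a n = Ψ.ν n ∧ ∀ i < n, Ψ.P i (a i) = Ψ.coeff i y ∧ Ψ.E i (a i) = a (i + 1)

/-- `Ψ` is *proper at order `n` w.r.t. `y`*: the backward recursion
`y_n^[n] = ν n`, `y_i^[n] = F i ⁻¹ (P̂_i y, y_{i+1}^[n])` is well defined. -/
def ProperAt (n : ℕ) (y : Ψ.S 0) : Prop := ∃ a, Ψ.IsChain n y a

/-- `z` is the `n`-th convergent `y^[n]` of `y` (the outcome `y_0^[n]` of the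
backward recursion). -/
def IsConvergent (n : ℕ) (y z : Ψ.S 0) : Prop := ∃ a, Ψ.IsChain n y a ∧ a 0 = z

end ExpansionSystem

namespace ExpansionSystem

variable {Ψ : ExpansionSystem} {n : ℕ} {y z : Ψ.S 0} {a : ∀ i, Ψ.S i}

theorem IsChain.iter_eq (ha : Ψ.IsChain n y a) {i : ℕ} (hi : i ≤ n) :
    Ψ.iter i (a 0) = a i := by
  induction i with
  | zero => rfl
  | succ i ih =>
    rw [iter, ih (by lia)]
    exact (ha.2 i hi).2

theorem IsConvergent.coeff_eq (h : Ψ.IsConvergent n y z) {i : ℕ} (hi : i < n) :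
    Ψ.coeff i z = Ψ.coeff i y := by
  obtain ⟨a, ha, rfl⟩ := h
  rw [coeff, ha.iter_eq hi.le]
  exact (ha.2 i hi).1

theorem IsConvergent.isChain_iff (h : Ψ.IsConvergent n y z) {k : ℕ} (hk : k ≤ n) :
    Ψ.IsChain k z a ↔ Ψ.IsChain k y a :=
  and_congr_right fun _ => forall₂_congr fun i hi => by rw [h.coeff_eq (hi.trans_le hk)]

end ExpansionSystem

/-- if `m ≤ n` and `Ψ` is proper w.r.t. `y` both at order `n` and at
order `m`, then `Ψ` is proper at orders `n` and `m` w.r.t. the convergent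
`y^[n]` as well, `(y^[n])^[m] = y^[m]`, and in particular `(y^[n])^[n] = y^[n]`. -/
theorem stmt4 (Ψ : ExpansionSystem) (m n : ℕ) (hmn : m ≤ n) (y : Ψ.S 0)
    (hn : Ψ.ProperAt n y) (hm : Ψ.ProperAt m y)
    (z : Ψ.S 0) (hz : Ψ.IsConvergent n y z) :
    Ψ.ProperAt n z ∧ Ψ.ProperAt m z ∧
      (∀ w : Ψ.S 0, Ψ.IsConvergent m z w ↔ Ψ.IsConvergent m y w) ∧
      Ψ.IsConvergent n z z := by
  simp only [ExpansionSystem.ProperAt, ExpansionSystem.IsConvergent, hz.isChain_iff hmn,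
    hz.isChain_iff le_rfl]
  exact ⟨hn, hm, fun _ => trivial, hz⟩
end

section
/- Let Ψ be a separating expansion system such that S_0 carries a topology and each C_i is a Hausdorff topological space, and suppose Ψ is proper at every order w.r.t. y ∈ S_0 and the sequence of convergents y^{[n]} converges in S_0 to some element y^{[∞]}. If the coefficient map P̂ : S_0 → ∏_{i∈ℕ} C_i (with the product topology) is continuous at y^{[∞]}, then y^{[∞]} = y, i.e. Ψ is accurate w.r.t. y. -/
/-- Along a chain of order `n`, the iterates of the starting point are the chain entries. -/
theorem ExpansionSystem.IsChain.iter_eq_s7 {Ψ : ExpansionSystem} {n : ℕ} {y : Ψ.S 0}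
    {a : ∀ i, Ψ.S i} (h : Ψ.IsChain n y a) : ∀ i ≤ n, Ψ.iter i (a 0) = a i
  | 0, _ => rfl
  | i + 1, hi => by
    rw [ExpansionSystem.iter, h.iter_eq_s7 i (Nat.le_of_succ_le hi), (h.2 i hi).2]

/-- The `n`-th convergent of `y` has the same coefficients as `y` below order `n`. -/
theorem ExpansionSystem.IsConvergent.coeff_eq_s7 {Ψ : ExpansionSystem} {n : ℕ} {y z : Ψ.S 0}
    (h : Ψ.IsConvergent n y z) {i : ℕ} (hi : i < n) : Ψ.coeff i z = Ψ.coeff i y := by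
  obtain ⟨a, ha, rfl⟩ := h
  rw [ExpansionSystem.coeff, ha.iter_eq_s7 i hi.le, (ha.2 i hi).1]

/-- let `Ψ` be separating, `S 0` a topological space, all `C i`
Hausdorff topological spaces, `Ψ` proper at every order w.r.t. `y`, and suppose the
convergents `y^[n]` converge to some `L ∈ S 0`. If the coefficient map `P̂` (into
`∏ i, C i` with the product topology) is continuous at `L`, then `L = y`, i.e. `Ψ`
is accurate w.r.t. `y`. -/
theorem stmt7 (Ψ : ExpansionSystem) [TopologicalSpace (Ψ.S 0)]
    [∀ i, TopologicalSpace (Ψ.C i)] [∀ i, T2Space (Ψ.C i)]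
    (hsep : Function.Injective Ψ.coeffMap)
    (y : Ψ.S 0) (hy : ∀ n, Ψ.ProperAt n y)
    (c : ℕ → Ψ.S 0) (hc : ∀ n, Ψ.IsConvergent n y (c n))
    (L : Ψ.S 0) (hL : Filter.Tendsto c Filter.atTop (nhds L))
    (hcont : ContinuousAt Ψ.coeffMap L) : L = y := by
  refine hsep (funext fun i => ?_)
  have hlim : Filter.Tendsto (fun n => Ψ.coeff i (c n)) Filter.atTop (nhds (Ψ.coeff i L)) :=
    (tendsto_pi_nhds.1 hcont.tendsto i).comp hL
  refine tendsto_nhds_unique hlim (tendsto_const_nhds.congr' ?_)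
  filter_upwards [Filter.eventually_gt_atTop i] with n hn
  exact ((hc n).coeff_eq_s7 hn).symm
end

section
/- Let Ψ be a strictly increasing expansion system and endow ∏_{i∈ℕ} C_i with the dictionary (lexicographic) order, in which two distinct sequences are compared at the first index where they differ. Then the coefficient map P̂ : S_0 → ∏ C_i is non-decreasing: y ≤ y′ in S_0 implies P̂ y ≤ P̂ y′ in the lexicographic order. -/
namespace ExpansionSystem

variable (Ψ : ExpansionSystem) [∀ i, LinearOrder (Ψ.S i)] [∀ i, LinearOrder (Ψ.C i)]

/-- `F i = (P i, E i)` is strictly increasing w.r.t. the dictionary order on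
`C i × S (i+1)`: for `y < y'` one has `P i y ≤ P i y'`, and `E i y < E i y'`
whenever `P i y = P i y'`. -/
def FIncreasingAt (i : ℕ) : Prop :=
  ∀ y y' : Ψ.S i, y < y' →
    Ψ.P i y ≤ Ψ.P i y' ∧ (Ψ.P i y = Ψ.P i y' → Ψ.E i y < Ψ.E i y')

/-- `F i = (P i, E i)` is strictly decreasing w.r.t. the dictionary order on
`C i × S (i+1)`. -/
def FDecreasingAt (i : ℕ) : Prop :=
  ∀ y y' : Ψ.S i, y < y' →
    Ψ.P i y' ≤ Ψ.P i y ∧ (Ψ.P i y = Ψ.P i y' → Ψ.E i y' < Ψ.E i y)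

/-- `Ψ` is a strictly increasing expansion system. -/
def StrictlyIncreasingES : Prop := ∀ i, Ψ.FIncreasingAt i

/-- `Ψ` is a monotonic expansion system: each `F i` is strictly monotone
(strictly increasing or strictly decreasing) w.r.t. the dictionary order. -/
def MonotonicES : Prop := ∀ i, Ψ.FIncreasingAt i ∨ Ψ.FDecreasingAt i

/-- The dictionary (lexicographic) strict order on coefficient sequences: two
distinct sequences are compared at the first index where they differ. -/
def lexLt (a b : ∀ i, Ψ.C i) : Prop :=
  ∃ k, (∀ i < k, a i = b i) ∧ a k < b k

end ExpansionSystem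

/-- If the coefficients of `y < y'` agree before index `n`, then `y_n < y'_n`. -/
theorem ExpansionSystem.StrictlyIncreasingES.iter_lt_iter {Ψ : ExpansionSystem}
    [∀ i, LinearOrder (Ψ.S i)] [∀ i, LinearOrder (Ψ.C i)]
    (hinc : Ψ.StrictlyIncreasingES) {y y' : Ψ.S 0} (h : y < y') (n : ℕ)
    (heq : ∀ i < n, Ψ.coeffMap y i = Ψ.coeffMap y' i) : Ψ.iter n y < Ψ.iter n y' := by
  induction n with
  | zero => exact h
  | succ n ih =>
    exact (hinc n _ _ (ih fun i hi => heq i (Nat.lt_succ_of_lt hi))).2 (heq n n.lt_succ_self)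

/-- if `Ψ` is a strictly increasing expansion system and `∏ i, C i`
carries the dictionary (lexicographic) order, then the coefficient map `P̂` is
non-decreasing: `y ≤ y'` implies `P̂ y ≤ P̂ y'` lexicographically. -/
theorem stmt11 (Ψ : ExpansionSystem) [∀ i, LinearOrder (Ψ.S i)] [∀ i, LinearOrder (Ψ.C i)]
    (hinc : Ψ.StrictlyIncreasingES) (y y' : Ψ.S 0) (h : y ≤ y') :
    Ψ.coeffMap y = Ψ.coeffMap y' ∨ Ψ.lexLt (Ψ.coeffMap y) (Ψ.coeffMap y') := by
  classical
  rcases h.eq_or_lt with rfl | hlt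
  · exact Or.inl rfl
  by_cases hne : ∃ i, Ψ.coeffMap y i ≠ Ψ.coeffMap y' i
  · have heq : ∀ i < Nat.find hne, Ψ.coeffMap y i = Ψ.coeffMap y' i :=
      fun i hi => not_not.mp (Nat.find_min hne hi)
    exact Or.inr ⟨Nat.find hne, heq, lt_of_le_of_ne
      (hinc _ _ _ (hinc.iter_lt_iter hlt _ heq)).1 (Nat.find_spec hne)⟩
  · push Not at hne
    exact Or.inl (funext hne)
end

section
/- Let Ψ be a monotonic expansion system. If the set S_0^{[<∞]} of elements of finite order (those y ∈ S_0 with y_n = ν_n for some n ∈ ℕ) is densely ordered in S_0, i.e. between any two distinct elements of S_0 there lies an element of S_0^{[<∞]}, then Ψ is separating. -/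
namespace ExpansionSystem

/-- Elements with the same coefficients below `n` and the same `n`-th iterate are equal. -/
theorem eq_of_iter_eq (Ψ : ExpansionSystem) {y z : Ψ.S 0} (n : ℕ)
    (hc : ∀ i < n, Ψ.coeff i y = Ψ.coeff i z) (h : Ψ.iter n y = Ψ.iter n z) : y = z := by
  induction n with
  | zero => exact h
  | succ n ih =>
    exact ih (fun i hi => hc i (hi.trans n.lt_succ_self))
      (Ψ.F_inj n (Prod.ext (hc n n.lt_succ_self) h))

/-- Once the expansion of an element reaches the neutral element, it stays neutral. -/
theorem iter_eq_ν_of_le (Ψ : ExpansionSystem) {y : Ψ.S 0} {m n : ℕ} (hmn : m ≤ n)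
    (h : Ψ.iter m y = Ψ.ν m) : Ψ.iter n y = Ψ.ν n := by
  induction n, hmn using Nat.le_induction with
  | base => exact h
  | succ n _ ih => rw [iter, ih, Ψ.E_ν]

/-- Finite-order elements with the same coefficients are equal. -/
theorem eq_of_finite_order (Ψ : ExpansionSystem) {y z : Ψ.S 0}
    (hy : ∃ n, Ψ.iter n y = Ψ.ν n) (hz : ∃ n, Ψ.iter n z = Ψ.ν n)
    (hc : ∀ i, Ψ.coeff i y = Ψ.coeff i z) : y = z := by
  obtain ⟨m, hm⟩ := hy
  obtain ⟨n, hn⟩ := hz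
  exact Ψ.eq_of_iter_eq (max m n) (fun i _ => hc i)
    ((Ψ.iter_eq_ν_of_le (le_max_left m n) hm).trans
      (Ψ.iter_eq_ν_of_le (le_max_right m n) hn).symm)

/-- One expansion step preserves strict betweenness, up to orientation, of elements whose
outer members share their coefficient. -/
theorem MonotonicES.step {Ψ : ExpansionSystem} [∀ i, LinearOrder (Ψ.S i)]
    [∀ i, LinearOrder (Ψ.C i)] (hmono : Ψ.MonotonicES) {i : ℕ} {x z w : Ψ.S i}
    (hP : Ψ.P i x = Ψ.P i w) (hxz : x < z) (hzw : z < w) :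
    Ψ.P i x = Ψ.P i z ∧ (Ψ.E i x < Ψ.E i z ∧ Ψ.E i z < Ψ.E i w ∨
      Ψ.E i w < Ψ.E i z ∧ Ψ.E i z < Ψ.E i x) := by
  rcases hmono i with h | h
  · have h₁ := h x z hxz
    have h₂ := h z w hzw
    have e : Ψ.P i x = Ψ.P i z := le_antisymm h₁.1 (hP ▸ h₂.1)
    exact ⟨e, .inl ⟨h₁.2 e, h₂.2 (e.symm.trans hP)⟩⟩
  · have h₁ := h x z hxz
    have h₂ := h z w hzw
    have e : Ψ.P i x = Ψ.P i z := le_antisymm (hP ▸ h₂.1) h₁.1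
    exact ⟨e, .inr ⟨h₂.2 (e.symm.trans hP), h₁.2 e⟩⟩

/-- An element strictly between two elements with the same coefficients shares them. -/
theorem MonotonicES.coeff_eq_of_between {Ψ : ExpansionSystem} [∀ i, LinearOrder (Ψ.S i)]
    [∀ i, LinearOrder (Ψ.C i)] (hmono : Ψ.MonotonicES) {x z w : Ψ.S 0}
    (hc : ∀ i, Ψ.coeff i x = Ψ.coeff i w) (hxz : x < z) (hzw : z < w) (i : ℕ) :
    Ψ.coeff i x = Ψ.coeff i z := by
  have between : Ψ.iter i x < Ψ.iter i z ∧ Ψ.iter i z < Ψ.iter i w ∨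
      Ψ.iter i w < Ψ.iter i z ∧ Ψ.iter i z < Ψ.iter i x := by
    induction i with
    | zero => exact .inl ⟨hxz, hzw⟩
    | succ i ih =>
      rcases ih with h | h
      · exact (hmono.step (hc i) h.1 h.2).2
      · exact (hmono.step (hc i).symm h.1 h.2).2.symm
  rcases between with h | h
  · exact (hmono.step (hc i) h.1 h.2).1
  · exact (hc i).trans (hmono.step (hc i).symm h.1 h.2).1

end ExpansionSystem

/-- if `Ψ` is a monotonic expansion system and the set of elements of
finite order is densely ordered in `S 0` (between any two distinct elements of
`S 0` lies an element of finite order), then `Ψ` is separating, i.e. the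
coefficient map `P̂` is injective. -/
theorem stmt12 (Ψ : ExpansionSystem) [∀ i, LinearOrder (Ψ.S i)] [∀ i, LinearOrder (Ψ.C i)]
    (hmono : Ψ.MonotonicES)
    (hdense : ∀ y y' : Ψ.S 0, y < y' →
      ∃ z : Ψ.S 0, (∃ n, Ψ.iter n z = Ψ.ν n) ∧ y < z ∧ z < y') :
    Function.Injective Ψ.coeffMap := by
  have key : ∀ y y' : Ψ.S 0, y < y' → Ψ.coeffMap y ≠ Ψ.coeffMap y' := by
    intro y y' hlt heq
    obtain ⟨z, hz, hyz, hzy'⟩ := hdense y y' hlt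
    have hcz := hmono.coeff_eq_of_between (congrFun heq) hyz hzy'
    obtain ⟨w, hw, hyw, hwz⟩ := hdense y z hyz
    have hcw := hmono.coeff_eq_of_between hcz hyw hwz
    exact hwz.ne (Ψ.eq_of_finite_order hw hz fun i => (hcw i).symm.trans (hcz i))
  intro y y' heq
  rcases lt_trichotomy y y' with h | h | h
  · exact absurd heq (key y y' h)
  · exact h
  · exact absurd heq.symm (key y' y h)
end

section
/- Let Λ = (Λ^S, Λ^C) be a homomorphism from an expansion system Ψ to an expansion system Ψ′. If Ψ is proper at order n w.r.t. y ∈ S_0, then Ψ′ is proper at order n w.r.t. Λ^S_0 y, and the convergents satisfy (Λ^S_0 y)^{[Ψ′,n]} = Λ^S_0 (y^{[Ψ,n]}). -/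
/-- A homomorphism `Λ = (Λ^S, Λ^C)` between expansion systems `Ψ` and `Ψ'`:
families of maps `Λ^S i : S i → S' i` and `Λ^C i : C i → C' i` respecting the
neutral elements, expansions and projections. -/
structure ESHom (Ψ Ψ' : ExpansionSystem) where
  ΛS : ∀ i, Ψ.S i → Ψ'.S i
  ΛC : ∀ i, Ψ.C i → Ψ'.C i
  map_ν : ∀ i, ΛS i (Ψ.ν i) = Ψ'.ν i
  map_E : ∀ i (y : Ψ.S i), ΛS (i + 1) (Ψ.E i y) = Ψ'.E i (ΛS i y)
  map_P : ∀ i (y : Ψ.S i), ΛC i (Ψ.P i y) = Ψ'.P i (ΛS i y)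

namespace ESHom

variable {Ψ Ψ' : ExpansionSystem} (Λ : ESHom Ψ Ψ')

theorem map_iter (i : ℕ) (y : Ψ.S 0) : Λ.ΛS i (Ψ.iter i y) = Ψ'.iter i (Λ.ΛS 0 y) := by
  induction i with
  | zero => rfl
  | succ i ih => simp only [ExpansionSystem.iter, Λ.map_E, ih]

theorem map_coeff (i : ℕ) (y : Ψ.S 0) : Λ.ΛC i (Ψ.coeff i y) = Ψ'.coeff i (Λ.ΛS 0 y) := by
  simp only [ExpansionSystem.coeff, Λ.map_P, Λ.map_iter]

theorem map_isChain {n : ℕ} {y : Ψ.S 0} {a : ∀ i, Ψ.S i} (ha : Ψ.IsChain n y a) :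
    Ψ'.IsChain n (Λ.ΛS 0 y) (fun i => Λ.ΛS i (a i)) := by
  refine ⟨?_, fun i hi => ⟨?_, ?_⟩⟩
  · simp only [ha.1, Λ.map_ν]
  · rw [← Λ.map_P, (ha.2 i hi).1, Λ.map_coeff]
  · rw [← Λ.map_E, (ha.2 i hi).2]

end ESHom

/-- if `Λ` is a homomorphism from `Ψ` to `Ψ'` and `Ψ` is proper at
order `n` w.r.t. `y`, then `Ψ'` is proper at order `n` w.r.t. `Λ^S 0 y`, and the
convergents satisfy `(Λ^S 0 y)^[Ψ',n] = Λ^S 0 (y^[Ψ,n])`. -/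
theorem stmt15 (Ψ Ψ' : ExpansionSystem) (Λ : ESHom Ψ Ψ') (n : ℕ) (y : Ψ.S 0)
    (h : Ψ.ProperAt n y) :
    Ψ'.ProperAt n (Λ.ΛS 0 y) ∧
      ∀ z : Ψ.S 0, Ψ.IsConvergent n y z → Ψ'.IsConvergent n (Λ.ΛS 0 y) (Λ.ΛS 0 z) := by
  refine ⟨?_, ?_⟩
  · obtain ⟨a, ha⟩ := h
    exact ⟨_, Λ.map_isChain ha⟩
  · rintro z ⟨a, ha, rfl⟩
    exact ⟨_, Λ.map_isChain ha, rfl⟩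
end
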